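/- (Markov property for configuration data defined by disks; final step of Proposition on virtual data.) For all triples t, t' ∈ O₃, one has t ⇝¹⁰⁰⁰ t'. In other words, the hypotheses (ii), (iii), (iv) on the disks D imply that the configuration data (W, O₃, O₄) satisfies the Markov chain condition (e) with constant p = 1000. -/

import Mathlib

open Topology

/-- The set of triples of pairwise distinct points of `W`. -/
def O3 (W : Type*) : Set (W × W × W) :=
  {t | t.1 ≠ t.2.1 ∧ t.1 ≠ t.2.2 ∧ t.2.1 ≠ t.2.2}

/-- The set of quadruples `(a,b,c,d)` with `(a,b,c) ∈ O₃` and `d ∈ D(a,b,c)`. -/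
def O4 {W : Type*} (D : W → W → W → Set W) : Set (W × W × W × W) :=
  {q | (q.1, q.2.1, q.2.2.1) ∈ O3 W ∧ q.2.2.2 ∈ D q.1 q.2.1 q.2.2.1}

/-- The initial triple `(q¹, q², q³)` of a quadruple. -/
def tri1 {W : Type*} (q : W × W × W × W) : W × W × W := (q.1, q.2.1, q.2.2.1)

/-- The final triple `(q³, q², q⁴)` of a quadruple. -/
def tri2 {W : Type*} (q : W × W × W × W) : W × W × W := (q.2.2.1, q.2.1, q.2.2.2)

/-- The triple `(q², q⁴, q³)` of a quadruple, one of the two admissible transitions. -/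
def stepA {W : Type*} (q : W × W × W × W) : W × W × W := (q.2.1, q.2.2.2, q.2.2.1)

/-- The triple `(q³, q², q⁴)` of a quadruple, the other admissible transition. -/
def stepB {W : Type*} (q : W × W × W × W) : W × W × W := (q.2.2.1, q.2.1, q.2.2.2)

/-- `Leads Q p t t'` (written `t ⇝ᵖ t'` in the paper): there is a chain `q₁, …, q_j`
of at most `p` quadruples of `Q` with `(q₁¹,q₁²,q₁³) = t`, `(q_j³,q_j²,q_j⁴) = t'`, and
consecutive quadruples related by one of the two admissible transitions. -/
def Leads {W : Type*} (Q : Set (W × W × W × W)) (p : ℕ) (t t' : W × W × W) : Prop :=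
  ∃ j : ℕ, 1 ≤ j ∧ j ≤ p ∧ ∃ q : ℕ → W × W × W × W,
    (∀ n < j, q n ∈ Q) ∧ tri1 (q 0) = t ∧ tri2 (q (j - 1)) = t' ∧
    ∀ n, n + 1 < j →
      tri1 (q (n + 1)) = stepA (q n) ∨ tri1 (q (n + 1)) = stepB (q n)

/-- `Reach Q n s t`: the triple `t` is obtained from `s` by at most `n` moves
`tri1 q ↦ stepA q` or `tri1 q ↦ stepB q` with `q ∈ Q`. -/
inductive Reach {W : Type*} (Q : Set (W × W × W × W)) : ℕ → W × W × W → W × W × W → Prop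
  | refl (n : ℕ) (t : W × W × W) : Reach Q n t t
  | step {n : ℕ} {u t : W × W × W} (q : W × W × W × W) (hq : q ∈ Q)
      (hu : u = stepA q ∨ u = stepB q) (h : Reach Q n u t) : Reach Q (n + 1) (tri1 q) t

theorem Reach.mono {W : Type*} {Q : Set (W × W × W × W)} {m n : ℕ} {s t : W × W × W}
    (h : Reach Q m s t) (hmn : m ≤ n) : Reach Q n s t := by
  induction h generalizing n with
  | refl => exact .refl _ _
  | step q hq hu _ ih =>
    obtain ⟨k, rfl⟩ : ∃ k, n = k + 1 := ⟨n - 1, by omega⟩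
    exact .step q hq hu (ih (by omega))

theorem Reach.trans {W : Type*} {Q : Set (W × W × W × W)} {m n : ℕ} {s t u : W × W × W}
    (h : Reach Q m s t) (h' : Reach Q n t u) : Reach Q (m + n) s u := by
  induction h with
  | refl => exact h'.mono (by omega)
  | step q hq hu _ ih => exact (Reach.step q hq hu (ih h')).mono (by omega)

theorem Leads.of_mem {W : Type*} {Q : Set (W × W × W × W)} {q : W × W × W × W} (hq : q ∈ Q) :
    Leads Q 1 (tri1 q) (tri2 q) :=
  ⟨1, le_rfl, le_rfl, fun _ => q, fun _ _ => hq, rfl, rfl, fun n hn => by omega⟩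

theorem Leads.mono {W : Type*} {Q : Set (W × W × W × W)} {m n : ℕ} {s t : W × W × W}
    (h : Leads Q m s t) (hmn : m ≤ n) : Leads Q n s t := by
  obtain ⟨j, h1, h2, h3⟩ := h
  exact ⟨j, h1, h2.trans hmn, h3⟩

theorem Leads.step {W : Type*} {Q : Set (W × W × W × W)} {n : ℕ} {u t : W × W × W}
    (h : Leads Q n u t) (q : W × W × W × W) (hq : q ∈ Q) (hu : u = stepA q ∨ u = stepB q) :
    Leads Q (n + 1) (tri1 q) t := by
  obtain ⟨j, hj1, hjn, r, hr, hr0, hrj, hstep⟩ := h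
  obtain ⟨k, rfl⟩ : ∃ k, j = k + 1 := ⟨j - 1, by omega⟩
  refine ⟨k + 2, by omega, by omega, fun i => Nat.casesOn i q r, ?_, rfl, ?_, ?_⟩
  · rintro (_ | i) hi
    · exact hq
    · exact hr i (by omega)
  · exact hrj
  · rintro (_ | i) hi
    · change tri1 (r 0) = _ ∨ tri1 (r 0) = _
      rwa [hr0]
    · exact hstep i (by omega)

theorem Reach.leads {W : Type*} {Q : Set (W × W × W × W)} {m n : ℕ} {s t u : W × W × W}
    (h : Reach Q m s t) (h' : Leads Q n t u) : Leads Q (m + n) s u := by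
  induction h with
  | refl => exact h'.mono (by omega)
  | step q hq hu _ ih => exact ((ih h').step q hq hu).mono (by omega)

/-- `Approaches Q n s t`: triples close to `s` reach triples arbitrarily close to `t` in at
most `n` moves. -/
def Approaches {W : Type*} [TopologicalSpace W] (Q : Set (W × W × W × W)) (n : ℕ)
    (s t : W × W × W) : Prop :=
  ∀ V ∈ 𝓝 t, ∀ᶠ s' in 𝓝 s, ∃ v ∈ V, Reach Q n s' v

namespace Approaches

variable {W : Type*} [TopologicalSpace W] {Q : Set (W × W × W × W)}

theorem mono {m n : ℕ} {s t : W × W × W} (h : Approaches Q m s t) (hmn : m ≤ n) :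
    Approaches Q n s t := fun V hV => by
  filter_upwards [h V hV] with s hs
  obtain ⟨v, hv, hr⟩ := hs
  exact ⟨v, hv, hr.mono hmn⟩

theorem trans {m n : ℕ} {s t u : W × W × W} (h : Approaches Q m s t) (h' : Approaches Q n t u) :
    Approaches Q (m + n) s u := fun V hV => by
  filter_upwards [h _ (h' V hV)] with s hs
  obtain ⟨v, ⟨w, hw, hvw⟩, hsv⟩ := hs
  exact ⟨w, hw, hsv.trans hvw⟩

theorem of_mem_closure {D : W → W → W → Set W} (hopen : IsOpen (O4 D)) {a b c d : W}
    (habc : (a, b, c) ∈ O3 W) (hd : d ∈ closure (D a b c)) {g : W × W × W × W → W × W × W}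
    (hg : Continuous g) (hstep : ∀ q, g q = stepA q ∨ g q = stepB q) :
    Approaches (O4 D) 1 (a, b, c) (g (a, b, c, d)) := fun V hV => by
  obtain ⟨U, hUV, hU, hdU⟩ := mem_nhds_iff.1 hV
  obtain ⟨w, hwU, hwD⟩ := mem_closure_iff.1 hd {w | g (a, b, c, w) ∈ U}
    (hU.preimage (by fun_prop)) hdU
  have hmove : IsOpen ((fun s : W × W × W => (s.1, s.2.1, s.2.2, w)) ⁻¹' (O4 D ∩ g ⁻¹' U)) :=
    (hopen.inter (hU.preimage hg)).preimage (by fun_prop)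
  filter_upwards [hmove.mem_nhds (x := (a, b, c)) ⟨⟨habc, hwD⟩, hwU⟩] with s hs
  exact ⟨_, hUV hs.2, .step (s.1, s.2.1, s.2.2, w) hs.1 (hstep _) (.refl 0 _)⟩

end Approaches

section Disks

variable {W : Type*} [TopologicalSpace W] {D : W → W → W → Set W}

theorem approaches_stepA (hopen : IsOpen (O4 D)) {a b c d : W}
    (habc : (a, b, c) ∈ O3 W) (hd : d ∈ closure (D a b c)) :
    Approaches (O4 D) 1 (a, b, c) (b, d, c) :=
  .of_mem_closure hopen habc hd (g := stepA) (by unfold stepA; fun_prop) fun _ => .inl rfl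

theorem approaches_stepB (hopen : IsOpen (O4 D)) {a b c d : W}
    (habc : (a, b, c) ∈ O3 W) (hd : d ∈ closure (D a b c)) :
    Approaches (O4 D) 1 (a, b, c) (c, b, d) :=
  .of_mem_closure hopen habc hd (g := stepB) (by unfold stepB; fun_prop) fun _ => .inr rfl

theorem approaches_swap_left (h3 : ∀ a b c : W, (a, b, c) ∈ O3 W → a ∈ closure (D a b c))
    (hopen : IsOpen (O4 D)) {a b c : W} (h : (a, b, c) ∈ O3 W) :
    Approaches (O4 D) 1 (a, b, c) (b, a, c) :=
  approaches_stepA hopen h (h3 a b c h)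

theorem approaches_swap_outer (h3 : ∀ a b c : W, (a, b, c) ∈ O3 W → a ∈ closure (D a b c))
    (hopen : IsOpen (O4 D)) {a b c : W} (h : (a, b, c) ∈ O3 W) :
    Approaches (O4 D) 1 (a, b, c) (c, b, a) :=
  approaches_stepB hopen h (h3 a b c h)

theorem approaches_swap_right (h3 : ∀ a b c : W, (a, b, c) ∈ O3 W → a ∈ closure (D a b c))
    (hopen : IsOpen (O4 D)) {a b c : W} (h : (a, b, c) ∈ O3 W) :
    Approaches (O4 D) 3 (a, b, c) (a, c, b) := by
  have ⟨h1, h2, h3'⟩ := h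
  exact ((approaches_swap_left h3 hopen h).trans
    (approaches_swap_outer h3 hopen ⟨h1.symm, h3', h2⟩)).trans
    (approaches_swap_left h3 hopen ⟨h2.symm, h3'.symm, h1⟩)

theorem approaches_replace_first
    (h2 : ∀ a b c : W, (a, b, c) ∈ O3 W → Dense (D a b c ∪ D a c b))
    (h3 : ∀ a b c : W, (a, b, c) ∈ O3 W → a ∈ closure (D a b c))
    (hopen : IsOpen (O4 D)) {a b c d : W} (h : (a, b, c) ∈ O3 W) (h' : (d, b, c) ∈ O3 W) :
    Approaches (O4 D) 8 (a, b, c) (d, b, c) := by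
  have ⟨hab, hac, hbc⟩ := h
  have ⟨hdb, hdc, _⟩ := h'
  have hd := h2 a b c h d
  rw [closure_union] at hd
  rcases hd with hd | hd
  · exact ((approaches_stepB hopen h hd).trans
      (approaches_swap_outer h3 hopen ⟨hbc.symm, hdc.symm, hdb.symm⟩)).mono (by norm_num)
  · exact (((approaches_swap_right h3 hopen h).trans
      (approaches_stepB hopen ⟨hac, hab, hbc.symm⟩ hd)).trans
      (approaches_swap_outer h3 hopen ⟨hbc, hdb.symm, hdc.symm⟩)).trans
      (approaches_swap_right h3 hopen ⟨hdc, hdb, hbc.symm⟩)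

theorem approaches_of_mem_O3
    (h2 : ∀ a b c : W, (a, b, c) ∈ O3 W → Dense (D a b c ∪ D a c b))
    (h3 : ∀ a b c : W, (a, b, c) ∈ O3 W → a ∈ closure (D a b c))
    (hopen : IsOpen (O4 D)) {s t : W × W × W} (hs : s ∈ O3 W) (ht : t ∈ O3 W) :
    Approaches (O4 D) 28 s t := by
  obtain ⟨a, b, c⟩ := s
  obtain ⟨x, y, z⟩ := t
  have ⟨hab, hac, hbc⟩ := hs
  have ⟨hxy, hxz, hyz⟩ := ht
  dsimp only at hab hac hbc hxy hxz hyz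
  obtain ⟨b', c', hs', hA⟩ : ∃ b' c', (x, b', c') ∈ O3 W ∧
      Approaches (O4 D) 8 (a, b, c) (x, b', c') := by
    by_cases hxb : x = b
    · subst hxb
      exact ⟨a, c, ⟨hab.symm, hbc, hac⟩, (approaches_swap_left h3 hopen hs).mono (by norm_num)⟩
    by_cases hxc : x = c
    · subst hxc
      exact ⟨b, a, ⟨hbc.symm, hac.symm, hab.symm⟩,
        (approaches_swap_outer h3 hopen hs).mono (by norm_num)⟩
    exact ⟨b, c, ⟨hxb, hxc, hbc⟩, approaches_replace_first h2 h3 hopen hs ⟨hxb, hxc, hbc⟩⟩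
  have ⟨hxb, hxc, hbc'⟩ := hs'
  dsimp only at hxb hxc hbc'
  obtain ⟨c'', hs'', hB⟩ : ∃ c'', (x, y, c'') ∈ O3 W ∧
      Approaches (O4 D) 10 (x, b', c') (x, y, c'') := by
    by_cases hyc : y = c'
    · subst hyc
      exact ⟨b', ⟨hxy, hxb, hbc'.symm⟩, (approaches_swap_right h3 hopen hs').mono (by norm_num)⟩
    refine ⟨c', ⟨hxy, hxc, hyc⟩, ?_⟩
    exact ((approaches_swap_left h3 hopen hs').trans
      (approaches_replace_first h2 h3 hopen ⟨hxb.symm, hbc', hxc⟩ ⟨hxy.symm, hyc, hxc⟩)).trans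
      (approaches_swap_left h3 hopen ⟨hxy.symm, hyc, hxc⟩)
  have ⟨_, hxc'', hyc''⟩ := hs''
  have hC : Approaches (O4 D) 10 (x, y, c'') (x, y, z) :=
    ((approaches_swap_outer h3 hopen hs'').trans
      (approaches_replace_first h2 h3 hopen ⟨hyc''.symm, hxc''.symm, hxy.symm⟩
        ⟨hyz.symm, hxz.symm, hxy.symm⟩)).trans
      (approaches_swap_outer h3 hopen ⟨hyz.symm, hxz.symm, hxy.symm⟩)
  exact (hA.trans hB).trans hC

theorem exists_nhds_leads
    (h3 : ∀ a b c : W, (a, b, c) ∈ O3 W → a ∈ closure (D a b c)) (hopen : IsOpen (O4 D))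
    (hdist : ∀ a b c d : W, (a, b, c, d) ∈ O4 D →
      a ≠ b ∧ a ≠ c ∧ a ≠ d ∧ b ≠ c ∧ b ≠ d ∧ c ≠ d)
    (hrev : ∀ a b c d : W, (a, b, c, d) ∈ O4 D → (d, c, b, a) ∈ O4 D)
    {t : W × W × W} (ht : t ∈ O3 W) :
    ∃ v ∈ O3 W, ∃ V ∈ 𝓝 v, ∀ u ∈ V, Leads (O4 D) 3 u t := by
  obtain ⟨b, c, a⟩ := t
  have ⟨hbc, hba, hca⟩ := ht
  have hne : ∀ {x y z : W}, (x, y, z) ∈ O3 W → ∃ w, (x, y, z, w) ∈ O4 D := fun {x y z} h =>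
    (closure_nonempty_iff.1 ⟨x, h3 x y z h⟩).imp fun _ hw => ⟨h, hw⟩
  obtain ⟨d, hd⟩ := hne (x := a) (y := b) (z := c) ⟨hba.symm, hca.symm, hbc⟩
  obtain ⟨-, -, -, -, hbd, hcd⟩ := hdist _ _ _ _ hd
  obtain ⟨e, he⟩ := hne (x := b) (y := d) (z := c) ⟨hbd, hbc, hcd.symm⟩
  obtain ⟨-, -, -, -, hde, hce⟩ := hdist _ _ _ _ he
  obtain ⟨f, hf⟩ := hne (x := c) (y := d) (z := e) ⟨hcd, hce, hde⟩
  have hf' := hrev _ _ _ _ hf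
  refine ⟨(f, e, d), hf'.1, {u | (u.1, u.2.1, u.2.2, c) ∈ O4 D ∧ (u.2.1, c, u.2.2, b) ∈ O4 D ∧
    (u.2.2, c, b, a) ∈ O4 D}, IsOpen.mem_nhds ?_ ⟨hf', hrev _ _ _ _ he, hrev _ _ _ _ hd⟩, ?_⟩
  · exact (hopen.preimage (by fun_prop)).inter
      ((hopen.preimage (by fun_prop)).inter (hopen.preimage (by fun_prop)))
  · rintro ⟨f, e, d⟩ ⟨hq₁, hq₂, hq₃⟩
    exact ((Leads.of_mem hq₃).step _ hq₂ (.inr rfl)).step _ hq₁ (.inl rfl)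

end Disks

/-- Final step: the configuration data defined by disks satisfying (ii), (iii), (iv)
is Markov with constant `p = 1000`: any two triples of `O₃` satisfy `t ⇝¹⁰⁰⁰ t'`. -/
theorem leads_markov {W : Type*} [MetricSpace W] (D : W → W → W → Set W)
    (h2 : ∀ a b c : W, (a, b, c) ∈ O3 W → Dense (D a b c ∪ D a c b))
    (h3 : ∀ a b c : W, (a, b, c) ∈ O3 W → a ∈ closure (D a b c))
    (h4open : IsOpen (O4 D))
    (h4dist : ∀ a b c d : W, (a, b, c, d) ∈ O4 D →
      a ≠ b ∧ a ≠ c ∧ a ≠ d ∧ b ≠ c ∧ b ≠ d ∧ c ≠ d)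
    (h4rev : ∀ a b c d : W, (a, b, c, d) ∈ O4 D → (d, c, b, a) ∈ O4 D)
    (t t' : W × W × W) (ht : t ∈ O3 W) (ht' : t' ∈ O3 W) :
    Leads (O4 D) 1000 t t' := by
  obtain ⟨v, hv, V, hV, hlead⟩ := exists_nhds_leads h3 h4open h4dist h4rev ht'
  obtain ⟨u, hu, hreach⟩ := (approaches_of_mem_O3 h2 h3 h4open ht hv V hV).self_of_nhds
  exact (hreach.leads (hlead u hu)).mono (by norm_num)
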